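/- arXiv:1605.09736 — 2 statements merged into one kernel-verified Lean document; each statement's English description precedes it below -/
import Mathlib

section
/- Let n ≥ 2, p ∈ {1,…,n−1} with gcd(n,p) = 1, q ∈ {1,…,n−1} with pq ≡ 1 (mod n), and let y be a type (i) coupling. Then for every ξ ∈ A_y^+ and every ℓ ∈ {1,…,n}: each denominator sin(Σ_{k=ℓ}^{m−1} ξ_k) (m = ℓ+1,…,ℓ+n−1) is strictly positive, and both z_ℓ(ξ,y) > 0 and z_ℓ(ξ,−y) > 0. -/
open Finset Matrix
open scoped BigOperators Real

noncomputable section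

/-- Entries of the `(n-1) × (n-1)` integer matrix `A` (1-based indices):
`A_{j,k} = 1` if `1 ≤ j ≤ n-p` and `j ≤ k < j+p`, `A_{j,k} = -1` if
`n-p < j ≤ n-1` and `j+p-n ≤ k < j`, and `0` otherwise. -/
def Aent (n p : ℕ) (j k : ℕ) : ℤ :=
  if j ≤ n - p ∧ j ≤ k ∧ k < j + p then 1
  else if n - p < j ∧ j + p ≤ k + n ∧ k < j then -1
  else 0

open Classical in
/-- Entries of the binary matrix `B`: `B_{m,k} = 0` iff `k - m ≡ ℓ p (mod n)`
for some `ℓ ∈ {1, …, n-q}`, else `1`. -/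
def Bent (n p q : ℕ) (m k : ℕ) : ℤ :=
  if ∃ ℓ ∈ Finset.Icc 1 (n - q), ((k : ℤ) - (m : ℤ)) ≡ ((ℓ * p : ℕ) : ℤ) [ZMOD (n : ℤ)]
  then 0 else 1

open Classical in
/-- Entries of the binary matrix `C`: `C_{m,k} = 0` iff `k ≡ ℓ p (mod n)`
for some `ℓ ∈ {1, …, n-q}`, else `1`. -/
def Cent (n p q : ℕ) (m k : ℕ) : ℤ :=
  if ∃ ℓ ∈ Finset.Icc 1 (n - q), ((k : ℤ)) ≡ ((ℓ * p : ℕ) : ℤ) [ZMOD (n : ℤ)]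
  then 0 else 1

/-- Entries of `Ω = B - C`. -/
def Ωent (n p q : ℕ) (m k : ℕ) : ℤ := Bent n p q m k - Cent n p q m k

/-- The matrix `A` as an `(n-1) × (n-1)` integer matrix. -/
def Amat (n p : ℕ) : Matrix (Fin (n - 1)) (Fin (n - 1)) ℤ :=
  fun j k => Aent n p (j.1 + 1) (k.1 + 1)

/-- The matrix `Ω = B - C` as an `(n-1) × (n-1)` integer matrix. -/
def Ωmat (n p q : ℕ) : Matrix (Fin (n - 1)) (Fin (n - 1)) ℤ :=
  fun j k => Ωent n p q (j.1 + 1) (k.1 + 1)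

/-- Cyclic window sum `ξ_ℓ + ξ_{ℓ+1} + ⋯ + ξ_{ℓ+d-1}`. -/
def wsum (ξ : ℕ → ℝ) (ℓ d : ℕ) : ℝ := ∑ m ∈ Finset.range d, ξ (ℓ + m)

/-- First type (i) interval: `(p/n - 1/(nq))π < y < pπ/n` (so `M = pπ - ny > 0`). -/
def typeI1 (n p q : ℕ) (y : ℝ) : Prop :=
  ((p : ℝ) / n - 1 / ((n : ℝ) * q)) * Real.pi < y ∧ y < (p : ℝ) * Real.pi / n

/-- Second type (i) interval: `pπ/n < y < (p/n + 1/(n(n-q)))π` (so `M = pπ - ny < 0`). -/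
def typeI2 (n p q : ℕ) (y : ℝ) : Prop :=
  (p : ℝ) * Real.pi / n < y ∧ y < ((p : ℝ) / n + 1 / ((n : ℝ) * ((n : ℝ) - q))) * Real.pi

/-- `M = pπ - ny`. -/
def Mval (n p : ℕ) (y : ℝ) : ℝ := (p : ℝ) * Real.pi - (n : ℝ) * y

/-- Membership of `ξ` (a cyclic sequence of reals, indices `1, …, n`) in the open
domain `A_y^+`: cyclic convention `ξ_{m+n} = ξ_m`, positivity, total sum `π`, and
`sgn(M)(ξ_j + ⋯ + ξ_{j+p-1} - y) > 0` for `j = 1, …, n`. -/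
def inAy (n p : ℕ) (y : ℝ) (ξ : ℕ → ℝ) : Prop :=
  (∀ m, ξ (m + n) = ξ m) ∧
  (∀ k, 1 ≤ k → k ≤ n → 0 < ξ k) ∧
  (∑ k ∈ Finset.Icc 1 n, ξ k = Real.pi) ∧
  (∀ j, 1 ≤ j → j ≤ n → 0 < Real.sign (Mval n p y) * (wsum ξ j p - y))

/-- `|u_j(ξ)|² = sgn(M) (ξ_j + ⋯ + ξ_{j+p-1} - y)`. -/
def usq (n p : ℕ) (y : ℝ) (ξ : ℕ → ℝ) (j : ℕ) : ℝ :=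
  Real.sign (Mval n p y) * (wsum ξ j p - y)

/-- `z_ℓ(ξ, w) = sgn(sin(ny)) ∏_{d=1}^{n-1} sin(ξ_ℓ + ⋯ + ξ_{ℓ+d-1} - w)/sin(ξ_ℓ + ⋯ + ξ_{ℓ+d-1})`;
the paper's `z_ℓ(ξ, ±y)` is obtained at `w = ±y`. -/
def zfun (n : ℕ) (y : ℝ) (ξ : ℕ → ℝ) (w : ℝ) (ℓ : ℕ) : ℝ :=
  Real.sign (Real.sin ((n : ℝ) * y)) *
    ∏ d ∈ Finset.Icc 1 (n - 1), Real.sin (wsum ξ ℓ d - w) / Real.sin (wsum ξ ℓ d)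

/-- `x_j - x_ℓ` expressed through `ξ`: `ξ_ℓ + ⋯ + ξ_{j-1}` for `ℓ ≤ j`, antisymmetric. -/
def xdiff (ξ : ℕ → ℝ) (j ℓ : ℕ) : ℝ :=
  if ℓ ≤ j then wsum ξ ℓ (j - ℓ) else -(wsum ξ j (ℓ - j))

/-- `ρ(θ)_ℓ = exp(i(θ_{ℓ-1} - θ_ℓ))` (with the conventions `θ_0 = θ_n = 0` imposed
as hypotheses on `θ`). -/
def ρfun (θ : ℕ → ℝ) (ℓ : ℕ) : ℂ :=
  Complex.exp (Complex.I * ((θ (ℓ - 1) - θ ℓ : ℝ) : ℂ))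

/-- `Δ_j(θ) = exp(i Σ_{k=1}^{n-1} Ω_{j,k} θ_k)` for `1 ≤ j ≤ n-1`, and `Δ_n(θ) = 1`. -/
def Δfun (n p q : ℕ) (θ : ℕ → ℝ) (j : ℕ) : ℂ :=
  if j = n then 1
  else Complex.exp (Complex.I *
    ((∑ k ∈ Finset.Icc 1 (n - 1), (Ωent n p q j k : ℝ) * θ k : ℝ) : ℂ))

/-- The local trigonometric Lax matrix
`L(ξ,θ)_{j,ℓ} = [sin y / sin(x_j - x_ℓ + y)] v_j(ξ,y) v_ℓ(ξ,-y) ρ(θ)_ℓ`. -/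
def Lloc (n : ℕ) (y : ℝ) (ξ θ : ℕ → ℝ) (j ℓ : ℕ) : ℂ :=
  ((Real.sin y / Real.sin (xdiff ξ j ℓ + y) : ℝ) : ℂ) *
    ((Real.sqrt (zfun n y ξ y j) : ℝ) : ℂ) *
    ((Real.sqrt (zfun n y ξ (-y) ℓ) : ℝ) : ℂ) * ρfun θ ℓ

/-- The embedding map `ℰ(ξ,θ)_j = |u_j(ξ)| Δ_j(θ)^{sgn M}` for `j = 1, …, n-1`
and `ℰ(ξ,θ)_n = |u_n(ξ)|` (note `Δ_n = 1`). -/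
def Emap (n p q : ℕ) (y : ℝ) (ξ θ : ℕ → ℝ) (j : ℕ) : ℂ :=
  ((Real.sqrt (usq n p y ξ j) : ℝ) : ℂ) *
    Δfun n p q θ j ^ (if 0 < Mval n p y then (1 : ℤ) else -1)

/-- `σ(ℓ) = ℓ + n - p` if `1 ≤ ℓ ≤ p`, and `σ(ℓ) = ℓ - p` if `p < ℓ ≤ n`. -/
def σmap (n p : ℕ) (ℓ : ℕ) : ℕ := if ℓ ≤ p then ℓ + n - p else ℓ - p

/-- The Weierstrass-type function
`ws_b(z) = sin z ∏_{m=1}^∞ (1 + sin² z / sinh²(2 m b))` with `ω = π/2`, `ω' = i b`. -/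
def wsb (b : ℝ) (z : ℂ) : ℂ :=
  Complex.sin z *
    ∏' m : ℕ, (1 + Complex.sin z ^ 2 / Complex.sinh (2 * ((m : ℂ) + 1) * (b : ℂ)) ^ 2)

/-- Elliptic analogue of `zfun`, built from `ws_b` instead of `sin`. -/
def zbfun (b : ℝ) (n : ℕ) (y : ℝ) (ξ : ℕ → ℝ) (w : ℝ) (ℓ : ℕ) : ℝ :=
  Real.sign ((wsb b (((n : ℝ) * y : ℝ) : ℂ)).re) *
    ∏ d ∈ Finset.Icc 1 (n - 1),
      (wsb b ((wsum ξ ℓ d - w : ℝ) : ℂ)).re / (wsb b ((wsum ξ ℓ d : ℝ) : ℂ)).re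

/-- The local elliptic Lax matrix with spectral parameter `lam`. -/
def Lbloc (b : ℝ) (n : ℕ) (y : ℝ) (lam : ℂ) (ξ θ : ℕ → ℝ) (j ℓ : ℕ) : ℂ :=
  (wsb b ((y : ℝ) : ℂ) / wsb b lam) *
    (wsb b (((xdiff ξ j ℓ : ℝ) : ℂ) + lam) / wsb b ((xdiff ξ j ℓ + y : ℝ) : ℂ)) *
    ((Real.sqrt (zbfun b n y ξ y j) : ℝ) : ℂ) *
    ((Real.sqrt (zbfun b n y ξ (-y) ℓ) : ℝ) : ℂ) * ρfun θ ℓ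

/-- The subset `S = {ℓ p mod n : ℓ = 1, …, n-q}` of `ℤ/nℤ`. -/
def Sset (n p q : ℕ) : Finset (ZMod n) :=
  (Finset.Icc 1 (n - q)).image (fun ℓ => ((ℓ * p : ℕ) : ZMod n))

/-- The subset `S_i = {i + ℓ mod n : ℓ = 0, …, p-1}` of `ℤ/nℤ`. -/
def Siset (n p : ℕ) (i : ZMod n) : Finset (ZMod n) :=
  (Finset.range p).image (fun ℓ : ℕ => i + (ℓ : ZMod n))

/-- `I_i = |S_i ∩ S|`. -/
def Inum (n p q : ℕ) (i : ZMod n) : ℕ := (Siset n p i ∩ Sset n p q).card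

/-- The function `W_j(ξ)` of Statement 13. -/
def Wfun (n p : ℕ) (y : ℝ) (ξ : ℕ → ℝ) (j : ℕ) : ℝ :=
  (Real.sin (usq n p y ξ j) / usq n p y ξ j) *
    ((-1 : ℝ) ^ (p - 1) / Real.sin (wsum ξ j p)) *
    ∏ d ∈ (Finset.Icc 1 (n - 1)).erase p,
      Real.sin (wsum ξ j d - y) / Real.sin (wsum ξ j d)

theorem wsum_add (ξ : ℕ → ℝ) (ℓ a b : ℕ) :
    wsum ξ ℓ (a + b) = wsum ξ ℓ a + wsum ξ (ℓ + a) b := by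
  simp only [wsum, Finset.sum_range_add, add_assoc]

theorem wsum_one (ξ : ℕ → ℝ) (ℓ : ℕ) : wsum ξ ℓ 1 = ξ ℓ := by
  simp [wsum]

theorem wsum_pos {ξ : ℕ → ℝ} (h : ∀ k, 0 < ξ k) (ℓ : ℕ) {d : ℕ} (hd : 1 ≤ d) :
    0 < wsum ξ ℓ d :=
  Finset.sum_pos (fun _ _ => h _) ⟨0, Finset.mem_range.2 hd⟩

theorem wsum_mono {ξ : ℕ → ℝ} (h : ∀ k, 0 < ξ k) (ℓ : ℕ) {a b : ℕ} (hab : a ≤ b) :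
    wsum ξ ℓ a ≤ wsum ξ ℓ b :=
  Finset.sum_le_sum_of_subset_of_nonneg (Finset.range_mono hab) fun _ _ _ => (h _).le

theorem le_wsum_mul {ξ : ℕ → ℝ} {p : ℕ} {c : ℝ} (h : ∀ j, c ≤ wsum ξ j p) (ℓ m : ℕ) :
    m * c ≤ wsum ξ ℓ (m * p) := by
  induction m with
  | zero => simp [wsum]
  | succ m ih =>
    rw [Nat.succ_mul, wsum_add]
    push_cast
    linarith [h (ℓ + m * p)]

theorem wsum_mul_le {ξ : ℕ → ℝ} {p : ℕ} {c : ℝ} (h : ∀ j, wsum ξ j p ≤ c) (ℓ m : ℕ) :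
    wsum ξ ℓ (m * p) ≤ m * c := by
  induction m with
  | zero => simp [wsum]
  | succ m ih =>
    rw [Nat.succ_mul, wsum_add]
    push_cast
    linarith [h (ℓ + m * p)]

theorem wsum_mul_eq {ξ : ℕ → ℝ} {p : ℕ} {c : ℝ} (h : ∀ j, wsum ξ j p = c) (ℓ m : ℕ) :
    wsum ξ ℓ (m * p) = m * c :=
  le_antisymm (wsum_mul_le (fun j => (h j).le) ℓ m) (le_wsum_mul (fun j => (h j).ge) ℓ m)

theorem wsum_periodic {ξ : ℕ → ℝ} {n : ℕ} (h : ∀ m, ξ (m + n) = ξ m) (d : ℕ) :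
    Function.Periodic (fun j => wsum ξ j d) n := fun j => by
  simp only [wsum]
  refine Finset.sum_congr rfl fun m _ => ?_
  rw [← h (j + m), add_right_comm]

theorem wsum_period {ξ : ℕ → ℝ} {n : ℕ} (h : ∀ m, ξ (m + n) = ξ m) (ℓ : ℕ) :
    wsum ξ ℓ n = ∑ k ∈ Finset.Icc 1 n, ξ k := by
  have step (j : ℕ) : wsum ξ (j + 1) n = wsum ξ j n := by
    have h₁ := wsum_add ξ j 1 n
    rw [add_comm 1 n, wsum_add, wsum_one, wsum_one, h] at h₁
    linarith
  have base : wsum ξ 1 n = ∑ k ∈ Finset.Icc 1 n, ξ k := by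
    rw [← Finset.Ico_add_one_right_eq_Icc, Finset.sum_Ico_eq_sum_range]
    rfl
  rw [← base, step 0]
  induction ℓ with
  | zero => rfl
  | succ j ih => rw [step, ih]

theorem forall_of_periodic {n : ℕ} (hn : 1 ≤ n) {P : ℕ → Prop} (hP : Function.Periodic P n)
    (h : ∀ j, 1 ≤ j → j ≤ n → P j) (j : ℕ) : P j := by
  rw [← hP.map_mod_nat j]
  rcases Nat.eq_zero_or_pos (j % n) with h₀ | h₀
  · rw [h₀, ← hP 0, zero_add]
    exact h n hn le_rfl
  · exact h _ h₀ (Nat.mod_lt _ hn).le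

theorem neg_one_pow_mul_prod_range_pos {k N : ℕ} (hk : k ≤ N) {f : ℕ → ℝ}
    (hneg : ∀ i < k, f i < 0) (hpos : ∀ i < N, k ≤ i → 0 < f i) :
    0 < (-1) ^ k * ∏ i ∈ Finset.range N, f i := by
  obtain ⟨m, rfl⟩ := Nat.exists_eq_add_of_le hk
  rw [Finset.prod_range_add, ← mul_assoc, ← Finset.card_range k, ← Finset.prod_const,
    Finset.card_range, ← Finset.prod_mul_distrib]
  refine mul_pos (Finset.prod_pos fun i hi => ?_) (Finset.prod_pos fun i hi => ?_)
  · linarith [hneg i (Finset.mem_range.1 hi)]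
  · exact hpos _ (by simpa using hi) (Nat.le_add_right _ _)

theorem sign_sin_eq_neg_one_pow {x : ℝ} {k : ℕ} (h₁ : k * π < x) (h₂ : x < (k + 1) * π) :
    Real.sign (Real.sin x) = (-1) ^ k := by
  have hs : 0 < Real.sin (x - k * π) := Real.sin_pos_of_pos_of_lt_pi (by linarith) (by linarith)
  have hx : Real.sin x = (-1) ^ k * Real.sin (x - k * π) := by
    rw [← Real.sin_add_nat_mul_pi, sub_add_cancel]
  rw [hx]
  rcases neg_one_pow_eq_or ℝ k with h | h <;> rw [h]
  · exact Real.sign_of_pos (by linarith)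
  · exact Real.sign_of_neg (by linarith)

theorem sin_wsum_pos {n : ℕ} {ξ : ℕ → ℝ} (hξ : ∀ k, 0 < ξ k) (htot : ∀ j, wsum ξ j n = π)
    (ℓ : ℕ) {d : ℕ} (h₁ : 1 ≤ d) (h₂ : d < n) : 0 < Real.sin (wsum ξ ℓ d) := by
  refine Real.sin_pos_of_pos_of_lt_pi (wsum_pos hξ ℓ h₁) ?_
  have h := wsum_add ξ ℓ d (n - d)
  rw [Nat.add_sub_of_le h₂.le, htot] at h
  linarith [wsum_pos hξ (ℓ + d) (show 1 ≤ n - d by omega)]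

theorem sin_wsum_sub_neg {ξ : ℕ → ℝ} (hξ : ∀ k, 0 < ξ k) {y : ℝ} (hy : y < π) {ℓ d : ℕ}
    (h₁ : 1 ≤ d) (h : wsum ξ ℓ d < y) : Real.sin (wsum ξ ℓ d - y) < 0 :=
  Real.sin_neg_of_neg_of_neg_pi_lt (by linarith) (by linarith [wsum_pos hξ ℓ h₁])

theorem sin_wsum_sub_pos {n : ℕ} {ξ : ℕ → ℝ} (hξ : ∀ k, 0 < ξ k) (htot : ∀ j, wsum ξ j n = π)
    {y : ℝ} (hy : 0 < y) {ℓ d : ℕ} (hd : d ≤ n) (h : y < wsum ξ ℓ d) :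
    0 < Real.sin (wsum ξ ℓ d - y) :=
  Real.sin_pos_of_pos_of_lt_pi (by linarith) (by linarith [wsum_mono hξ ℓ hd, htot ℓ])

theorem sin_wsum_add {n : ℕ} {ξ : ℕ → ℝ} (htot : ∀ j, wsum ξ j n = π) (y : ℝ) (ℓ : ℕ) {d : ℕ}
    (hd : d ≤ n) : Real.sin (wsum ξ ℓ d + y) = Real.sin (wsum ξ (ℓ + d) (n - d) - y) := by
  have h := wsum_add ξ ℓ d (n - d)
  rw [Nat.add_sub_of_le hd, htot] at h
  rw [← Real.sin_pi_sub]
  congr 1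
  linarith

theorem zfun_pos_of_prod_pos {n k : ℕ} {y : ℝ} {ξ : ℕ → ℝ} {w : ℝ} {ℓ : ℕ}
    (hsign : Real.sign (Real.sin (n * y)) = (-1) ^ k)
    (hden : ∀ d, 1 ≤ d → d ≤ n - 1 → 0 < Real.sin (wsum ξ ℓ d))
    (hnum : 0 < (-1) ^ k * ∏ d ∈ Finset.Icc 1 (n - 1), Real.sin (wsum ξ ℓ d - w)) :
    0 < zfun n y ξ w ℓ := by
  rw [zfun, hsign, Finset.prod_div_distrib, ← mul_div_assoc]
  refine div_pos hnum (Finset.prod_pos fun d hd => ?_)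
  rw [Finset.mem_Icc] at hd
  exact hden d hd.1 hd.2

/-- Positivity of `z_ℓ(ξ, ±y)` when `y` separates the cyclic window sums of length at most `k`
from the longer ones. -/
theorem zfun_pos_of_separates {n k : ℕ} (hk : k < n) {y : ℝ} (hy₀ : 0 < y) (hyπ : y < π)
    {ξ : ℕ → ℝ} (hξ : ∀ m, 0 < ξ m) (htot : ∀ j, wsum ξ j n = π)
    (hlow : ∀ j d, d ≤ k → wsum ξ j d < y) (hhigh : ∀ j d, k < d → y < wsum ξ j d)
    (hsign : Real.sign (Real.sin (n * y)) = (-1) ^ k) (ℓ : ℕ) :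
    0 < zfun n y ξ y ℓ ∧ 0 < zfun n y ξ (-y) ℓ := by
  have hden (d : ℕ) (h₁ : 1 ≤ d) (h₂ : d ≤ n - 1) : 0 < Real.sin (wsum ξ ℓ d) :=
    sin_wsum_pos hξ htot ℓ h₁ (by omega)
  constructor <;> refine zfun_pos_of_prod_pos hsign hden ?_ <;>
    rw [← Finset.Ico_add_one_right_eq_Icc, Finset.prod_Ico_eq_prod_range, Nat.add_sub_cancel]
  · refine neg_one_pow_mul_prod_range_pos (by omega) (fun i hi => ?_) fun i hi hki => ?_
    · exact sin_wsum_sub_neg hξ hyπ (by omega) (hlow _ _ (by omega))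
    · exact sin_wsum_sub_pos hξ htot hy₀ (by omega) (hhigh _ _ (by omega))
  · rw [← Finset.prod_range_reflect]
    refine neg_one_pow_mul_prod_range_pos (by omega) (fun i hi => ?_) fun i hi hki => ?_
    · rw [sub_neg_eq_add, sin_wsum_add htot _ _ (by omega)]
      exact sin_wsum_sub_neg hξ hyπ (by omega) (hlow _ _ (by omega))
    · rw [sub_neg_eq_add, sin_wsum_add htot _ _ (by omega)]
      exact sin_wsum_sub_pos hξ htot hy₀ (by omega) (hhigh _ _ (by omega))

/-- If all windows of length `p` exceed `y`, all windows of length `p - 1` stay below `y`. -/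
theorem wsum_pred_lt {n p q r : ℕ} (hp : 1 ≤ p) (hq : 1 ≤ q) (hr : p * q = r * n + 1) {y : ℝ}
    {ξ : ℕ → ℝ} (htot : ∀ j, wsum ξ j n = π) (hwin : ∀ j, y < wsum ξ j p) (hy : r * π < q * y)
    (ℓ : ℕ) : wsum ξ ℓ (p - 1) < y := by
  obtain ⟨q, rfl⟩ := Nat.exists_eq_add_of_le' hq
  have h := wsum_add ξ ℓ (p - 1) (q * p)
  have hlen : p - 1 + q * p = r * n := by
    rw [mul_add, mul_comm p q] at hr
    omega
  rw [hlen, wsum_mul_eq htot] at h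
  have h' := le_wsum_mul (fun j => (hwin j).le) (ℓ + (p - 1)) q
  push_cast at hy
  linarith

/-- If all windows of length `p` stay below `y`, all windows of length `p + 1` exceed `y`. -/
theorem lt_wsum_succ {n p s t : ℕ} (hs : 1 ≤ s) (ht : p * s + 1 = t * n) {y : ℝ}
    {ξ : ℕ → ℝ} (htot : ∀ j, wsum ξ j n = π) (hwin : ∀ j, wsum ξ j p < y) (hy : s * y < t * π)
    (ℓ : ℕ) : y < wsum ξ ℓ (p + 1) := by
  obtain ⟨s, rfl⟩ := Nat.exists_eq_add_of_le' hs
  have h := wsum_add ξ ℓ (p + 1) (s * p)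
  have hlen : p + 1 + s * p = t * n := by
    rw [← ht]
    ring
  rw [hlen, wsum_mul_eq htot] at h
  have h' := wsum_mul_le (fun j => (hwin j).le) (ℓ + (p + 1)) s
  push_cast at hy
  linarith

theorem exists_mul_eq_of_modEq {n p q : ℕ} (hp : 1 ≤ p) (hq : 1 ≤ q) (h : p * q ≡ 1 [MOD n]) :
    ∃ r, p * q = r * n + 1 := by
  obtain ⟨r, hr⟩ := (Nat.modEq_iff_dvd' (Nat.mul_pos hp hq)).1 h.symm
  refine ⟨r, ?_⟩
  have : 1 ≤ p * q := Nat.mul_pos hp hq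
  rw [mul_comm r n, ← hr]
  omega

theorem typeI1.bounds {n p q : ℕ} {y : ℝ} (h : typeI1 n p q y) (hn : 1 ≤ n) (hq : 1 ≤ q) :
    (p * q - 1) * π < n * (q * y) ∧ n * y < p * π := by
  have hn' : (0 : ℝ) < n := by exact_mod_cast hn
  have hq' : (0 : ℝ) < q := by exact_mod_cast hq
  obtain ⟨h₁, h₂⟩ := h
  constructor
  · calc (p * q - 1) * π = n * (q * (((p : ℝ) / n - 1 / (n * q)) * π)) := by field_simp
      _ < n * (q * y) := by gcongr
  · rwa [lt_div_iff₀ hn', mul_comm] at h₂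

theorem typeI2.bounds {n p q : ℕ} {y : ℝ} (h : typeI2 n p q y) (hn : 1 ≤ n) (hq : q < n) :
    p * π < n * y ∧ n * (((n : ℝ) - q) * y) < (p * ((n : ℝ) - q) + 1) * π := by
  have hn' : (0 : ℝ) < n := by exact_mod_cast hn
  have hq' : (0 : ℝ) < (n : ℝ) - q := sub_pos.2 (by exact_mod_cast hq)
  obtain ⟨h₁, h₂⟩ := h
  constructor
  · rwa [div_lt_iff₀ hn', mul_comm y] at h₁
  · calc n * (((n : ℝ) - q) * y)
        < n * (((n : ℝ) - q) * (((p : ℝ) / n + 1 / (n * ((n : ℝ) - q))) * π)) := by gcongr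
      _ = (p * ((n : ℝ) - q) + 1) * π := by field_simp

/-- For `ξ ∈ A_y^+` and `ℓ ∈ {1, …, n}`: every denominator
`sin(ξ_ℓ + ⋯ + ξ_{ℓ+d-1})`, `d = 1, …, n-1`, is strictly positive, and
`z_ℓ(ξ,y) > 0`, `z_ℓ(ξ,-y) > 0`. -/
theorem stmt12 (n p q : ℕ) (hn : 2 ≤ n) (hp1 : 1 ≤ p) (hpn : p ≤ n - 1)
    (hgcd : Nat.gcd n p = 1) (hq1 : 1 ≤ q) (hqn : q ≤ n - 1)
    (hpq : p * q ≡ 1 [MOD n])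
    (y : ℝ) (hy : typeI1 n p q y ∨ typeI2 n p q y)
    (ξ : ℕ → ℝ) (hξ : inAy n p y ξ)
    (ℓ : ℕ) (hℓ1 : 1 ≤ ℓ) (hℓn : ℓ ≤ n) :
    (∀ d, 1 ≤ d → d ≤ n - 1 → 0 < Real.sin (wsum ξ ℓ d)) ∧
    0 < zfun n y ξ y ℓ ∧ 0 < zfun n y ξ (-y) ℓ := by
  have hn₁ : 1 ≤ n := by omega
  have hnR : (0 : ℝ) < n := by exact_mod_cast hn₁
  have hpR : (1 : ℝ) ≤ p := by exact_mod_cast hp1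
  have hqR : (1 : ℝ) ≤ q := by exact_mod_cast hq1
  have hpnR : (p : ℝ) + 1 ≤ n := by exact_mod_cast (by omega : p + 1 ≤ n)
  have hqnR : (q : ℝ) + 1 ≤ n := by exact_mod_cast (by omega : q + 1 ≤ n)
  have hπ := Real.pi_pos
  obtain ⟨hper, hpos, hsum, hwin⟩ := hξ
  replace hpos : ∀ k, 0 < ξ k :=
    forall_of_periodic hn₁ (fun m => by simp only [hper]) hpos
  have htot (j : ℕ) : wsum ξ j n = π := (wsum_period hper j).trans hsum
  replace hwin : ∀ j, 0 < Real.sign (Mval n p y) * (wsum ξ j p - y) :=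
    forall_of_periodic hn₁ (fun m => by
      simp only [show wsum ξ (m + n) p = wsum ξ m p from wsum_periodic hper p m]) hwin
  refine ⟨fun d h₁ h₂ => sin_wsum_pos hpos htot ℓ h₁ (by omega), ?_⟩
  obtain ⟨r, hr⟩ := exists_mul_eq_of_modEq hp1 hq1 hpq
  have hrR : (p : ℝ) * q = r * n + 1 := by exact_mod_cast hr
  rcases hy with hy | hy
  · obtain ⟨hlo, hup⟩ := hy.bounds hn₁ hq1
    have hM : Real.sign (Mval n p y) = 1 := Real.sign_of_pos (sub_pos.2 hup)
    simp only [hM, one_mul, sub_pos] at hwin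
    have hqy : r * π < q * y := by
      refine lt_of_mul_lt_mul_left ?_ hnR.le
      rw [hrR] at hlo
      linarith
    have hy₀ : 0 < y := by
      have : 0 ≤ r * π := by positivity
      exact pos_of_mul_pos_right (this.trans_lt hqy) (by linarith)
    have hyπ : y < π := by nlinarith
    have hny : (p - 1) * π < n * y := by
      refine lt_of_mul_lt_mul_left ?_ (zero_le_one.trans hqR)
      nlinarith
    refine zfun_pos_of_separates (k := p - 1) (by omega) hy₀ hyπ hpos htot ?_ ?_ ?_ ℓ
    · exact fun j d hd => (wsum_mono hpos j hd).trans_lt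
        (wsum_pred_lt hp1 hq1 hr htot hwin hqy j)
    · exact fun j d hd => (hwin j).trans_le (wsum_mono hpos j (by omega))
    · apply sign_sin_eq_neg_one_pow <;> push_cast [Nat.cast_sub hp1] <;> linarith
  · obtain ⟨hlo, hup⟩ := hy.bounds hn₁ (by omega)
    have hM : Real.sign (Mval n p y) = -1 := Real.sign_of_neg (sub_neg.2 hlo)
    have hwin' (j : ℕ) : wsum ξ j p < y := by
      have := hwin j
      rw [hM] at this
      linarith
    have hy₀ : 0 < y := (wsum_pos hpos 0 hp1).trans (hwin' 0)
    have hny : n * y < (p + 1) * π := by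
      refine lt_of_mul_lt_mul_left ?_ (show (0 : ℝ) ≤ (n : ℝ) - q by linarith)
      nlinarith
    have hyπ : y < π := by nlinarith
    have hrp : r ≤ p := by
      refine le_of_mul_le_mul_right ?_ (show 0 < n by omega)
      have : p * q ≤ p * n := Nat.mul_le_mul_left p (by omega)
      omega
    have hlen : p * (n - q) + 1 = (p - r) * n := by
      zify [hrp, show q ≤ n by omega] at hr ⊢
      linarith
    have hsy : ((n - q : ℕ) : ℝ) * y < (p - r : ℕ) * π := by
      rw [Nat.cast_sub hrp, Nat.cast_sub (by omega)]
      refine lt_of_mul_lt_mul_left (hup.trans_le (le_of_eq ?_)) hnR.le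
      linear_combination (-π) * hrR
    refine zfun_pos_of_separates (k := p) (by omega) hy₀ hyπ hpos htot ?_ ?_ ?_ ℓ
    · exact fun j d hd => (wsum_mono hpos j hd).trans_lt (hwin' j)
    · exact fun j d hd => (lt_wsum_succ (by omega) hlen htot hwin' hsy j).trans_le
        (wsum_mono hpos j hd)
    · exact sign_sin_eq_neg_one_pow hlo hny

end
end

section
/- For every z ∈ ℂ, the limit as b → ∞ of ws_b(z) equals sin(z), i.e. lim_{b→∞} sin(z)·∏_{m=1}^∞ (1 + sin²(z)/sinh²(2mb)) = sin(z). -/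
open Finset Matrix
open scoped BigOperators Real

noncomputable section

/-- For `b > 0`, the `m`-th term of the product defining `wsb` is dominated by a multiple of
`((m + 1) * b)⁻²`. -/
theorem norm_div_sinh_sq_le (w : ℂ) {b : ℝ} (hb : 0 < b) (m : ℕ) :
    ‖w / Complex.sinh (2 * ((m : ℂ) + 1) * (b : ℂ)) ^ 2‖ ≤ ‖w‖ / (((m : ℝ) + 1) * b) ^ 2 := by
  have hcast : Complex.sinh (2 * ((m : ℂ) + 1) * (b : ℂ)) =
      ((Real.sinh (2 * ((m : ℝ) + 1) * b) : ℝ) : ℂ) := by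
    push_cast
    rfl
  have hpos : 0 < ((m : ℝ) + 1) * b := by positivity
  have hle : ((m : ℝ) + 1) * b ≤ Real.sinh (2 * ((m : ℝ) + 1) * b) :=
    le_trans (by linarith) (Real.self_le_sinh_iff.2 (by positivity))
  rw [hcast, norm_div, norm_pow, Complex.norm_real, Real.norm_of_nonneg (hpos.le.trans hle)]
  gcongr

/-- The trigonometric limit: `ws_b(z) → sin(z)` as `b → ∞`. -/
theorem stmt16 (z : ℂ) :
    Filter.Tendsto (fun b : ℝ => wsb b z) Filter.atTop (nhds (Complex.sin z)) := by
  have hsum : Summable fun m : ℕ => ‖Complex.sin z ^ 2‖ / ((m : ℝ) + 1) ^ 2 := by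
    have h := (summable_nat_add_iff 1).2 (Real.summable_one_div_nat_pow.2 one_lt_two)
    simpa [div_eq_mul_inv, -norm_pow] using h.mul_left ‖Complex.sin z ^ 2‖
  have hprod := tendsto_tprod_one_add_of_dominated_convergence (𝓕 := Filter.atTop)
    (f := fun (b : ℝ) (m : ℕ) =>
      Complex.sin z ^ 2 / Complex.sinh (2 * ((m : ℂ) + 1) * (b : ℂ)) ^ 2)
    (g := fun _ => 0) hsum ?_ ?_
  · simpa [wsb] using hprod.const_mul (Complex.sin z)
  · intro m
    have hlim : Filter.Tendsto (fun b : ℝ => (((m : ℝ) + 1) * b) ^ 2)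
        Filter.atTop Filter.atTop :=
      (Filter.tendsto_pow_atTop two_ne_zero).comp
        (Filter.tendsto_id.const_mul_atTop (by positivity))
    refine squeeze_zero_norm' ?_ (hlim.const_div_atTop ‖Complex.sin z ^ 2‖)
    filter_upwards [Filter.eventually_gt_atTop 0] with b hb
    exact norm_div_sinh_sq_le _ hb m
  · filter_upwards [Filter.eventually_ge_atTop 1] with b hb m
    refine (norm_div_sinh_sq_le _ (by linarith) m).trans ?_
    gcongr
    exact le_mul_of_one_le_right (by positivity) hb

end
end
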